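/- Let B be a finitely accessible additive category. Then the homotopy category K(B) is locally well generated. -/

import Mathlib

namespace LocWellGen

open CategoryTheory CategoryTheory.Limits CategoryTheory.Pretriangulated ZeroObject

universe v u

variable (T : Type u) [Category.{v} T] [HasZeroObject T] [HasShift T ℤ]
  [Preadditive T] [∀ n : ℤ, (shiftFunctor T n).Additive] [Pretriangulated T]

/-- A localizing subcategory of a pretriangulated category, given as a class of objects:
a full triangulated subcategory closed under isomorphisms and (existing) coproducts. -/
structure IsLocalizing (L : Set T) : Prop where
  zero : (0 : T) ∈ L
  isoClosed : ∀ {X Y : T}, (X ≅ Y) → X ∈ L → Y ∈ L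
  shiftClosed : ∀ (X : T) (n : ℤ), X ∈ L → X⟦n⟧ ∈ L
  ext₂ : ∀ D ∈ distTriang T, D.obj₁ ∈ L → D.obj₃ ∈ L → D.obj₂ ∈ L
  coproductClosed : ∀ {I : Type v} (X : I → T), (∀ i, X i ∈ L) →
    ∀ (c : Cofan X), IsColimit c → c.pt ∈ L

/-- `Loc S` : the smallest localizing subcategory containing `S`. -/
def Loc (S : Set T) : Set T := ⋂₀ {L : Set T | IsLocalizing T L ∧ S ⊆ L}

/-- `Y` is `κ`-small: any morphism from `Y` to a coproduct (of objects of `L`) factors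
through a subcoproduct with fewer than `κ` summands. -/
def IsKappaSmall (L : Set T) (κ : Cardinal.{v}) (Y : T) : Prop :=
  ∀ {I : Type v} (X : I → T), (∀ i, X i ∈ L) →
    ∀ (c : Cofan X), IsColimit c → ∀ f : Y ⟶ c.pt,
      ∃ (J : Set I) (c' : Cofan fun j : J => X j) (hc' : IsColimit c') (g : Y ⟶ c'.pt),
        Cardinal.mk J < κ ∧
        f = g ≫ hc'.desc (Cofan.mk c.pt fun j : J => c.inj j.1)

/-- Condition (3) of well generation: every morphism from `Y` to a coproduct of a family
in `L` factors through a coproduct of objects of `S` via a coproduct of morphisms. -/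
def FactorsThroughFamily (L S : Set T) (Y : T) : Prop :=
  ∀ {I : Type v} (X : I → T), (∀ i, X i ∈ L) →
    ∀ (c : Cofan X), IsColimit c → ∀ f : Y ⟶ c.pt,
      ∃ (Z : I → T) (_ : ∀ i, Z i ∈ S) (φ : ∀ i, Z i ⟶ X i)
        (cz : Cofan Z) (hcz : IsColimit cz) (g : Y ⟶ cz.pt),
        f = g ≫ hcz.desc (Cofan.mk c.pt fun i => φ i ≫ c.inj i)

/-- The set `S` witnesses that the (localizing sub)category `L` is `κ`-well generated. -/
structure GeneratesWell (L : Set T) (κ : Cardinal.{v}) (S : Set T) : Prop where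
  subset : S ⊆ L
  isSmall : Small.{v} ↥S
  nondegenerate : ∀ X ∈ L, (∀ Y ∈ S, ∀ f : Y ⟶ X, f = 0) → IsZero X
  kappaSmall : ∀ Y ∈ S, IsKappaSmall T L κ Y
  factors : ∀ Y ∈ S, FactorsThroughFamily T L S Y

/-- `L` is a `κ`-well generated (localizing sub)category. -/
def IsWellGeneratedOfCard (L : Set T) (κ : Cardinal.{v}) : Prop :=
  κ.IsRegular ∧ ∃ S : Set T, GeneratesWell T L κ S

/-- `L` is a well generated (localizing sub)category. -/
def IsWellGeneratedSubcat (L : Set T) : Prop :=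
  ∃ κ : Cardinal.{v}, IsWellGeneratedOfCard T L κ

/-- compactly generated = `ℵ₀`-well generated -/
def IsCompactlyGeneratedSubcat (L : Set T) : Prop :=
  IsWellGeneratedOfCard T L Cardinal.aleph0

/-- The whole category `T` is well generated. -/
abbrev IsWellGenerated : Prop := IsWellGeneratedSubcat T Set.univ

/-- A localizing subcategory `L` is locally well generated if the localizing subcategory
generated by any set of its objects is well generated. -/
def IsLocallyWellGeneratedSubcat (L : Set T) : Prop :=
  ∀ S : Set T, S ⊆ L → Small.{v} ↥S → IsWellGeneratedSubcat T (Loc T S)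

/-- `T` is locally well generated. -/
abbrev IsLocallyWellGenerated : Prop := IsLocallyWellGeneratedSubcat T Set.univ

/-- `Y` is a retract (direct summand) of `X`. -/
def IsRetractOf {B : Type*} [Category B] (Y X : B) : Prop :=
  ∃ (s : Y ⟶ X) (r : X ⟶ Y), s ≫ r = 𝟙 Y

end LocWellGen

namespace LocWellGen

open CategoryTheory CategoryTheory.Limits

universe v u
/-- An additive category with arbitrary coproducts is pure semisimple if it has an
additive generator: `B = Add X` for some `X`, i.e. every object is a direct summand
of a coproduct of copies of `X`. -/
def IsPureSemisimple (B : Type u) [Category.{v} B] : Prop :=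
  ∃ X : B, ∀ Y : B, ∃ (I : Type v) (c : Cofan fun _ : I => X) (_ : IsColimit c),
    IsRetractOf Y c.pt

end LocWellGen

namespace LocWellGen


open CategoryTheory CategoryTheory.Limits

universe v u

/-- An object `X` is finitely presentable if `Hom(X,-)` preserves filtered colimits. -/
def IsFinitelyPresentable (B : Type u) [Category.{v} B] (X : B) : Prop :=
  ∀ (J : Type v) (cJ : SmallCategory J),
    (by exact IsFiltered J →
      Nonempty (PreservesColimitsOfShape J (coyoneda.obj (Opposite.op X))) : Prop)

/-- A presentation of `X` as a colimit of a filtered diagram. -/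
structure FilteredColimitPresentation (B : Type u) [Category.{v} B] (X : B) where
  /-- the index category -/
  J : Type v
  [cat : SmallCategory J]
  [filtered : IsFiltered J]
  /-- the diagram -/
  D : J ⥤ B
  /-- a cocone on the diagram -/
  c : Cocone D
  /-- which is a colimit cocone -/
  hc : IsColimit c
  /-- whose point is isomorphic to `X` -/
  iso : c.pt ≅ X

attribute [instance] FilteredColimitPresentation.cat FilteredColimitPresentation.filtered

/-- `B` is finitely accessible: it has filtered colimits and there is a set of finitely
presentable objects such that every object is a filtered colimit of objects of this set. -/
def IsFinitelyAccessible (B : Type u) [Category.{v} B] : Prop :=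
  (∀ (J : Type v) (cJ : SmallCategory J),
    (by exact IsFiltered J → HasColimitsOfShape J B : Prop)) ∧
  ∃ (ι : Type v) (G : ι → B), (∀ i, IsFinitelyPresentable B (G i)) ∧
    ∀ X : B, ∃ p : FilteredColimitPresentation B X, ∀ j, p.D.obj j ∈ Set.range G

section Approximation

variable {T : Type u} [Category.{v} T]

/-- Any morphism from `Y` to `X` factors through an object of `Q`. -/
def FactorsThrough (Q : Set T) (Y X : T) : Prop :=
  ∀ f : Y ⟶ X, ∃ W ∈ Q, ∃ (a : Y ⟶ W) (b : W ⟶ X), a ≫ b = f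

variable [Preadditive T] [HasCoproducts.{v} T]

/-- Morphisms from an object of `P` to a coproduct of objects of `L` factor through a coproduct
of morphisms with sources in `Q`, fewer than `κ` of which are nonzero. -/
def Approximates (κ : Cardinal.{v}) (L P Q : Set T) : Prop :=
  ∀ Y ∈ P, ∀ {I : Type v} (X : I → T), (∀ i, X i ∈ L) → ∀ f : Y ⟶ ∐ X,
    ∃ (Z : I → T) (φ : ∀ i, Z i ⟶ X i) (g : Y ⟶ ∐ Z), (∀ i, Z i ∈ Q) ∧
      Cardinal.mk {i | φ i ≠ 0} < κ ∧ g ≫ Limits.Sigma.map φ = f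

/-- A coproduct of morphisms factors through the coproduct of the sources of those which are
nonzero. -/
lemma sigmaMap_eq_comp_desc {I : Type v} {Z X : I → T} (φ : ∀ i, Z i ⟶ X i) :
    ∃ r : ∐ Z ⟶ ∐ fun j : {i | φ i ≠ 0} => Z j,
      Limits.Sigma.map φ = r ≫ Sigma.desc fun j => φ j ≫ Sigma.ι X j := by
  classical
  refine ⟨Sigma.desc fun i => if h : φ i ≠ 0 then
    Sigma.ι (fun j : {i | φ i ≠ 0} => Z j) ⟨i, h⟩ else 0, ?_⟩
  refine Limits.Sigma.hom_ext _ _ fun i => ?_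
  by_cases h : φ i = 0
  · simp [h]
  · simp [h]

lemma Approximates.of_factorsThrough {κ : Cardinal.{v}} {L P Q : Set T}
    {L' : Set T} (hL : L' ⊆ L) (h : Approximates κ L P P)
    (hQ : ∀ X ∈ L', ∀ Y ∈ P, FactorsThrough Q Y X) : Approximates κ L' P Q := by
  classical
  intro Y hY I X hX f
  obtain ⟨Z, φ, g, hZ, hφ, rfl⟩ := h Y hY X (fun i => hL (hX i)) f
  choose W hW a b hab using fun i => hQ (X i) (hX i) (Z i) (hZ i) (φ i)
  refine ⟨W, fun i => if φ i = 0 then 0 else b i, g ≫ Limits.Sigma.map a, hW, ?_, ?_⟩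
  · refine (Cardinal.mk_le_mk_of_subset fun i hi => ?_).trans_lt hφ
    intro h
    simp [h] at hi
  · rw [Category.assoc]
    congr 1
    refine Limits.Sigma.hom_ext _ _ fun i => ?_
    by_cases h : φ i = 0
    · simp [h]
    · simp [h, reassoc_of% hab i]

end Approximation

section WellGeneration

open CategoryTheory.Pretriangulated ZeroObject

variable (T : Type u) [Category.{v} T] [HasZeroObject T] [HasShift T ℤ]
  [Preadditive T] [∀ n : ℤ, (shiftFunctor T n).Additive] [Pretriangulated T]

/-- A `κ`-localizing class of objects: a full triangulated subcategory closed under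
isomorphisms and coproducts with fewer than `κ` summands. -/
structure IsKappaLocalizing (κ : Cardinal.{v}) (P : Set T) : Prop where
  zero : (0 : T) ∈ P
  isoClosed : ∀ {X Y : T}, (X ≅ Y) → X ∈ P → Y ∈ P
  shiftClosed : ∀ (X : T) (n : ℤ), X ∈ P → X⟦n⟧ ∈ P
  ext₂ : ∀ D ∈ distTriang T, D.obj₁ ∈ P → D.obj₃ ∈ P → D.obj₂ ∈ P
  coproductClosed : ∀ {I : Type v} (X : I → T), Cardinal.mk I < κ → (∀ i, X i ∈ P) →
    ∀ (c : Cofan X), IsColimit c → c.pt ∈ P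

/-- The smallest `κ`-localizing class containing `S`. -/
def KappaLoc (κ : Cardinal.{v}) (S : Set T) : Set T :=
  ⋂₀ {P : Set T | IsKappaLocalizing T κ P ∧ S ⊆ P}

variable {T}

lemma IsLocalizing.isKappaLocalizing {L : Set T} (h : IsLocalizing T L) (κ : Cardinal.{v}) :
    IsKappaLocalizing T κ L where
  zero := h.zero
  isoClosed := h.isoClosed
  shiftClosed := h.shiftClosed
  ext₂ := h.ext₂
  coproductClosed X _ hX c hc := h.coproductClosed X hX c hc

lemma isLocalizing_loc (S : Set T) : IsLocalizing T (Loc T S) where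
  zero := fun _ h => h.1.zero
  isoClosed e hX := fun _ h => h.1.isoClosed e (hX _ h)
  shiftClosed X n hX := fun _ h => h.1.shiftClosed X n (hX _ h)
  ext₂ D hD h₁ h₃ := fun _ h => h.1.ext₂ D hD (h₁ _ h) (h₃ _ h)
  coproductClosed X hX c hc := fun _ h => h.1.coproductClosed X (fun i => hX i _ h) c hc

lemma isKappaLocalizing_kappaLoc (κ : Cardinal.{v}) (S : Set T) :
    IsKappaLocalizing T κ (KappaLoc T κ S) where
  zero := fun _ h => h.1.zero
  isoClosed e hX := fun _ h => h.1.isoClosed e (hX _ h)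
  shiftClosed X n hX := fun _ h => h.1.shiftClosed X n (hX _ h)
  ext₂ D hD h₁ h₃ := fun _ h => h.1.ext₂ D hD (h₁ _ h) (h₃ _ h)
  coproductClosed X hI hX c hc := fun _ h =>
    h.1.coproductClosed X hI (fun i => hX i _ h) c hc

lemma subset_loc (S : Set T) : S ⊆ Loc T S := fun _ hX _ h => h.2 hX

lemma subset_kappaLoc (κ : Cardinal.{v}) (S : Set T) : S ⊆ KappaLoc T κ S :=
  fun _ hX _ h => h.2 hX

lemma loc_subset {S L : Set T} (hL : IsLocalizing T L) (h : S ⊆ L) : Loc T S ⊆ L :=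
  fun _ hX => hX _ ⟨hL, h⟩

lemma kappaLoc_subset {κ : Cardinal.{v}} {S P : Set T} (hP : IsKappaLocalizing T κ P)
    (h : S ⊆ P) : KappaLoc T κ S ⊆ P :=
  fun _ hX => hX _ ⟨hP, h⟩

lemma kappaLoc_subset_loc (κ : Cardinal.{v}) (S : Set T) : KappaLoc T κ S ⊆ Loc T S :=
  kappaLoc_subset ((isLocalizing_loc S).isKappaLocalizing κ) (subset_loc S)

/-- The objects of `L` such that all morphisms to them from objects of `P` factor through `Q` are
closed under extensions. -/
lemma factorsThrough_obj₂ {κ : Cardinal.{v}} {P Q : Set T} (hP : IsKappaLocalizing T κ P)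
    (hQ : IsKappaLocalizing T κ Q) (hQP : Q ⊆ P)
    (D : Triangle T) (hD : D ∈ distTriang T)
    (h₁ : ∀ Y ∈ P, FactorsThrough Q Y D.obj₁)
    (h₁' : ∀ Y ∈ P, FactorsThrough Q Y (D.obj₁⟦(1 : ℤ)⟧))
    (h₃ : ∀ Y ∈ P, FactorsThrough Q Y D.obj₃) (Y : T) (hY : Y ∈ P) :
    FactorsThrough Q Y D.obj₂ := by
  intro f
  obtain ⟨W₃, hW₃, a, b, hab⟩ := h₃ Y hY (f ≫ D.mor₂)
  obtain ⟨C, p, q, hC⟩ := distinguished_cocone_triangle a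
  have hCP : C ∈ P := hP.ext₂ _ (rot_of_distTriang _ hC) (hQP hW₃) (hP.shiftClosed _ _ hY)
  obtain ⟨k, hk⟩ : ∃ k : C ⟶ D.obj₁⟦(1 : ℤ)⟧, b ≫ D.mor₃ = p ≫ k :=
    Triangle.yoneda_exact₂ _ hC (b ≫ D.mor₃) (by
      change a ≫ b ≫ D.mor₃ = 0
      rw [reassoc_of% hab, comp_distTriang_mor_zero₂₃ _ hD, comp_zero])
  obtain ⟨V, hV, s, t, rfl⟩ := h₁' C hCP k
  obtain ⟨x, hx⟩ := (shiftFunctor T (1 : ℤ)).map_surjective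
    ((shiftNegShift V (1 : ℤ)).hom ≫ t)
  obtain ⟨u, hu, hu'⟩ : ∃ u : W₃ ⟶ V⟦(-1 : ℤ)⟧⟦(1 : ℤ)⟧, a ≫ u = 0 ∧
      u ≫ x⟦(1 : ℤ)⟧' = b ≫ D.mor₃ := by
    have hap : a ≫ p = 0 := comp_distTriang_mor_zero₁₂ _ hC
    refine ⟨p ≫ s ≫ (shiftNegShift V (1 : ℤ)).inv, ?_, ?_⟩
    · rw [reassoc_of% hap, zero_comp]
    · rw [hx, Category.assoc, Category.assoc, Iso.inv_hom_id_assoc, hk]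
  obtain ⟨W₂, i, j, hW⟩ := distinguished_cocone_triangle₂ u
  have hW₂ : W₂ ∈ Q := hQ.ext₂ _ hW (hQ.shiftClosed _ _ hV) hW₃
  obtain ⟨m, hm⟩ : ∃ m : W₂ ⟶ D.obj₂, j ≫ b = m ≫ D.mor₂ := by
    obtain ⟨m, -, hm⟩ := complete_distinguished_triangle_morphism₂ _ _ hW hD x b hu'
    exact ⟨m, hm⟩
  obtain ⟨l, rfl⟩ : ∃ l : Y ⟶ W₂, a = l ≫ j := Triangle.coyoneda_exact₃ _ hW a hu
  obtain ⟨n, hn⟩ := Triangle.coyoneda_exact₂ _ hD (f - l ≫ m) (by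
    rw [Preadditive.sub_comp, Category.assoc, ← hm, ← hab, Category.assoc, sub_self])
  obtain ⟨W', hW', c, d, rfl⟩ := h₁ Y hY n
  refine ⟨W₂ ⊞ W', hQ.ext₂ _ (binaryBiproductTriangle_distinguished W₂ W') hW₂ hW',
    biprod.lift l c, biprod.desc m (d ≫ D.mor₁), ?_⟩
  rw [biprod.lift_desc, ← Category.assoc, ← hn]
  abel

variable [HasCoproducts.{v} T]

lemma factorsThrough_loc {κ : Cardinal.{v}} {L P S : Set T} (hL : IsLocalizing T L)
    (hP : IsKappaLocalizing T κ P) (hLP : Approximates κ L P P) (hSP : S ⊆ P) (hSL : S ⊆ L) :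
    ∀ X ∈ Loc T S, ∀ Y ∈ P, FactorsThrough (KappaLoc T κ S) Y X := by
  have hQ := isKappaLocalizing_kappaLoc κ S
  suffices H : IsLocalizing T
      {X | X ∈ L ∧ ∀ Y ∈ P, FactorsThrough (KappaLoc T κ S) Y X} from
    fun X hX => (loc_subset H (fun X hX => ⟨hSL hX, fun Y _ f =>
      ⟨X, subset_kappaLoc κ S hX, f, 𝟙 X, Category.comp_id f⟩⟩) hX).2
  have hshift (X : T) (n : ℤ) (hX : ∀ Y ∈ P, FactorsThrough (KappaLoc T κ S) Y X) :
      ∀ Y ∈ P, FactorsThrough (KappaLoc T κ S) Y (X⟦n⟧) := by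
    intro Y hY f
    obtain ⟨g, hg⟩ := (shiftFunctor T n).map_surjective ((shiftNegShift Y n).hom ≫ f)
    obtain ⟨W, hW, a, b, rfl⟩ := hX _ (hP.shiftClosed Y (-n) hY) g
    refine ⟨W⟦n⟧, hQ.shiftClosed _ _ hW, (shiftNegShift Y n).inv ≫ a⟦n⟧', b⟦n⟧', ?_⟩
    rw [Category.assoc, ← Functor.map_comp, hg, Iso.inv_hom_id_assoc]
  constructor
  · exact ⟨hL.zero, fun Y _ f => ⟨0, hQ.zero, 0, 0, (isZero_zero T).eq_of_tgt _ _⟩⟩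
  · rintro X X' e ⟨hX, hX'⟩
    refine ⟨hL.isoClosed e hX, fun Y hY f => ?_⟩
    obtain ⟨W, hW, a, b, hab⟩ := hX' Y hY (f ≫ e.inv)
    exact ⟨W, hW, a, b ≫ e.hom, by rw [reassoc_of% hab, e.inv_hom_id, Category.comp_id]⟩
  · rintro X n ⟨hX, hX'⟩
    exact ⟨hL.shiftClosed X n hX, hshift X n hX'⟩
  · rintro D hD ⟨h₁, h₁'⟩ ⟨h₃, h₃'⟩
    exact ⟨hL.ext₂ D hD h₁ h₃, factorsThrough_obj₂ hP hQ (kappaLoc_subset hP hSP) D hD h₁'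
      (hshift _ _ h₁') h₃'⟩
  · intro I X hX c hc
    refine ⟨hL.coproductClosed X (fun i => (hX i).1) c hc, fun Y hY f => ?_⟩
    obtain ⟨Z, φ, g, hZ, hφ, hg⟩ := (hLP.of_factorsThrough (fun X hX => hX.1)
      (fun X hX => hX.2)) Y hY X hX (f ≫ hc.desc (Cofan.mk _ (Sigma.ι X)))
    obtain ⟨r, hr⟩ := sigmaMap_eq_comp_desc φ
    refine ⟨∐ fun j : {i | φ i ≠ 0} => Z j, hQ.coproductClosed _ hφ (fun j => hZ j) _
      (colimit.isColimit _), g ≫ r,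
      (Sigma.desc fun j => φ j ≫ Sigma.ι X j) ≫ Sigma.desc fun i => c.inj i, ?_⟩
    rw [Category.assoc, ← reassoc_of% hr, reassoc_of% hg]
    conv_rhs => rw [← Category.comp_id f]
    congr 1
    exact Cofan.IsColimit.hom_ext hc _ _ fun i => by simp

/-- If an essentially small `κ`-localizing class `P` approximates coproducts in a localizing
class `L`, then any set of objects of `P` in `L` generates a well generated subcategory. -/
theorem isWellGeneratedOfCard_loc {κ : Cardinal.{v}} (hκ : κ.IsRegular) {L P S : Set T}
    (hL : IsLocalizing T L) (hP : IsKappaLocalizing T κ P) (hLP : Approximates κ L P P)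
    {A : Type v} (R : A → T) (hR : ∀ X ∈ P, ∃ a, Nonempty (R a ≅ X))
    (hSP : S ⊆ P) (hSL : S ⊆ L) : IsWellGeneratedOfCard T (Loc T S) κ := by
  have hQ := isKappaLocalizing_kappaLoc κ S
  have hQP : KappaLoc T κ S ⊆ P := kappaLoc_subset hP hSP
  have happ : Approximates κ (Loc T S) P (KappaLoc T κ S) :=
    hLP.of_factorsThrough (loc_subset hL hSL) (factorsThrough_loc hL hP hLP hSP hSL)
  refine ⟨hκ, {X | X ∈ KappaLoc T κ S ∧ X ∈ Set.range R}, ?_, ?_, ?_, ?_, ?_⟩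
  · exact fun X hX => kappaLoc_subset_loc κ S hX.1
  · exact small_subset (fun X hX => hX.2)
  · intro X hX h
    have h0 : ∀ Y ∈ KappaLoc T κ S, ∀ f : Y ⟶ X, f = 0 := by
      intro Y hY f
      obtain ⟨a, ⟨e⟩⟩ := hR Y (hQP hY)
      rw [← cancel_epi e.hom, comp_zero]
      exact h _ ⟨hQ.isoClosed e.symm hY, a, rfl⟩ _
    have H : IsLocalizing T {Y | ∀ (n : ℤ) (f : Y⟦n⟧ ⟶ X), f = 0} := by
      constructor
      · exact fun n f => ((shiftFunctor T n).map_isZero (isZero_zero T)).eq_of_src _ _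
      · intro Y Y' e hY n f
        rw [← cancel_epi ((shiftFunctor T n).map e.hom), comp_zero]
        exact hY n _
      · intro Y n hY m f
        rw [← cancel_epi ((shiftFunctorAdd T n m).hom.app Y), comp_zero]
        exact hY _ _
      · intro D hD h₁ h₃ n f
        obtain ⟨g, hg⟩ := Triangle.yoneda_exact₂ _ (Triangle.shift_distinguished _ hD n) f
          (h₁ n _)
        rw [hg]
        exact (congrArg _ (h₃ n g)).trans comp_zero
      · intro I Y hY c hc n f
        have : IsColimit ((shiftFunctor T n).mapCocone c) := isColimitOfPreserves _ hc
        exact this.hom_ext fun ⟨i⟩ => (hY i n _).trans comp_zero.symm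
    have hX0 := loc_subset H (fun Y hY n f =>
      h0 _ (hQ.shiftClosed _ _ (subset_kappaLoc κ S hY)) f) hX 0
      ((shiftFunctorZero T ℤ).hom.app X)
    have hX1 := (shiftFunctorZero T ℤ).inv_hom_id_app X
    rw [hX0, comp_zero] at hX1
    exact (IsZero.iff_id_eq_zero X).2 hX1.symm
  · intro Y hY I X hX c hc f
    obtain ⟨Z, φ, g, hZ, hφ, hg⟩ := happ Y (hQP hY.1) X hX
      (f ≫ hc.desc (Cofan.mk _ (Sigma.ι X)))
    obtain ⟨r, hr⟩ := sigmaMap_eq_comp_desc φ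
    refine ⟨{i | φ i ≠ 0}, _, colimit.isColimit _, g ≫ r ≫ Limits.Sigma.map fun j => φ j,
      hφ, ?_⟩
    have hr' := hr =≫ Sigma.desc fun i => c.inj i
    have hf : f = f ≫ hc.desc (Cofan.mk _ (Sigma.ι X)) ≫ Sigma.desc fun i => c.inj i := by
      conv_lhs => rw [← Category.comp_id f]
      congr 1
      exact Cofan.IsColimit.hom_ext hc _ _ fun i => by simp
    rw [hf, ← reassoc_of% hg, hr']
    simp only [Category.assoc]
    congr 2
    refine Limits.Sigma.hom_ext _ _ fun j => ?_
    simp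
  · intro Y hY I X hX c hc f
    obtain ⟨Z, φ, g, hZ, hφ, hg⟩ := happ Y (hQP hY.1) X hX
      (f ≫ hc.desc (Cofan.mk _ (Sigma.ι X)))
    choose a e using fun i => hR (Z i) (hQP (hZ i))
    have e i := (e i).some
    refine ⟨fun i => R (a i), fun i => ⟨hQ.isoClosed (e i).symm (hZ i), a i, rfl⟩,
      fun i => (e i).hom ≫ φ i, _, colimit.isColimit _,
      g ≫ Limits.Sigma.map fun i => (e i).inv, ?_⟩
    have hf : f = f ≫ hc.desc (Cofan.mk _ (Sigma.ι X)) ≫ Sigma.desc fun i => c.inj i := by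
      conv_lhs => rw [← Category.comp_id f]
      congr 1
      exact Cofan.IsColimit.hom_ext hc _ _ fun i => by simp
    rw [hf, ← reassoc_of% hg, Category.assoc]
    congr 1
    refine Limits.Sigma.hom_ext _ _ fun j => ?_
    simp

end WellGeneration


section Cardinals

open Cardinal

lemma mk_iUnion_lt_of_countable {κ : Cardinal.{v}} (hκ : κ.IsRegular) (hκ' : ℵ₀ < κ)
    {N : Type} [Countable N] {E : Type v} (t : N → Set E) (ht : ∀ n, #(t n) < κ) :
    #(⋃ n, t n) < κ := by
  have : ⋃ n, t n = ⋃ n : ULift.{v} N, t n.down := (Equiv.ulift.surjective.iUnion_comp t).symm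
  rw [this, card_iUnion_lt_iff_forall_of_isRegular hκ ((mk_le_aleph0).trans_lt hκ')]
  exact fun n => ht n.down

/-- A small subset is contained in a small subset which is stable under a multivalued map with
small values. -/
lemma exists_stable_superset {κ : Cardinal.{v}} (hκ : κ.IsRegular) (hκ' : ℵ₀ < κ)
    {E : Type v} (D : E → Set E) (hD : ∀ e, #(D e) < κ) (A : Set E) (hA : #A < κ) :
    ∃ A' : Set E, A ⊆ A' ∧ #A' < κ ∧ ∀ e ∈ A', D e ⊆ A' := by
  obtain ⟨F, hF₀, hF₁⟩ : ∃ F : ℕ → Set E, F 0 = A ∧ ∀ n, F (n + 1) = ⋃ e ∈ F n, D e :=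
    ⟨fun n => Nat.rec A (fun _ S => ⋃ e ∈ S, D e) n, rfl, fun _ => rfl⟩
  have hF (n : ℕ) : #(F n) < κ := by
    induction n with
    | zero => rwa [hF₀]
    | succ n hn =>
      rw [hF₁]
      exact (card_biUnion_lt_iff_forall_of_isRegular hκ hn).2 fun e _ => hD e
  refine ⟨⋃ n, F n, hF₀ ▸ Set.subset_iUnion F 0, mk_iUnion_lt_of_countable hκ hκ' F hF, ?_⟩
  intro e he
  obtain ⟨n, hn⟩ := Set.mem_iUnion.1 he
  exact ((Set.subset_biUnion_of_mem (u := D) hn).trans (hF₁ n).ge).trans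
    (Set.subset_iUnion F (n + 1))

end Cardinals

section SmallObjects

variable {B : Type u} [Category.{v} B]

lemma cofan_hom_ext {I : Type*} {X : I → B} {V : B} {j : ∀ i, X i ⟶ V}
    (h : IsColimit (Cofan.mk V j)) {W : B} {f g : V ⟶ W} (hfg : ∀ i, j i ≫ f = j i ≫ g) :
    f = g :=
  Cofan.IsColimit.hom_ext h _ _ hfg

@[simp]
lemma cofan_fac {I : Type*} {X : I → B} {V : B} {j : ∀ i, X i ⟶ V}
    (h : IsColimit (Cofan.mk V j)) {W : B} (f : ∀ i, X i ⟶ W) (i : I) :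
    j i ≫ Cofan.IsColimit.desc h f = f i :=
  Cofan.IsColimit.fac h f i

@[simp]
lemma cofan_fac_assoc {I : Type*} {X : I → B} {V : B} {j : ∀ i, X i ⟶ V}
    (h : IsColimit (Cofan.mk V j)) {W W' : B} (f : ∀ i, X i ⟶ W) (k : W ⟶ W') (i : I) :
    j i ≫ Cofan.IsColimit.desc h f ≫ k = f i ≫ k := by
  rw [← Category.assoc, cofan_fac]

variable [Preadditive B]

open Classical in
/-- The endomorphism of a coproduct which is the identity on the summands in `J` and zero on the
others. -/
noncomputable def restrict {I : Type*} {X : I → B} {V : B} {j : ∀ i, X i ⟶ V}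
    (h : IsColimit (Cofan.mk V j)) (J : Set I) : V ⟶ V :=
  Cofan.IsColimit.desc h fun i => if i ∈ J then j i else 0

section

variable {I : Type*} {X : I → B} {V : B} {j : ∀ i, X i ⟶ V} (h : IsColimit (Cofan.mk V j))

lemma inj_restrict_of_mem {J : Set I} {i : I} (hi : i ∈ J) : j i ≫ restrict h J = j i := by
  simp [restrict, hi]

lemma inj_restrict_of_notMem {J : Set I} {i : I} (hi : i ∉ J) : j i ≫ restrict h J = 0 := by
  simp [restrict, hi]

lemma restrict_comp_restrict {J J' : Set I} (hJ : J ⊆ J') :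
    restrict h J ≫ restrict h J' = restrict h J := by
  refine cofan_hom_ext h fun i => ?_
  by_cases hi : i ∈ J
  · rw [← Category.assoc, inj_restrict_of_mem h hi, inj_restrict_of_mem h (hJ hi)]
  · rw [← Category.assoc, inj_restrict_of_notMem h hi, zero_comp]

lemma comp_restrict_of_subset {J J' : Set I} (hJ : J ⊆ J') {W : B} {f : W ⟶ V}
    (hf : f ≫ restrict h J = f) : f ≫ restrict h J' = f := by
  rw [← hf, Category.assoc, restrict_comp_restrict h hJ]

end

/-- Morphisms from `X` to a coproduct factor through fewer than `κ` summands. -/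
def IsSmallObject (κ : Cardinal.{v}) (X : B) : Prop :=
  ∀ {I : Type v} (V : I → B) (W : B) (j : ∀ i, V i ⟶ W) (h : IsColimit (Cofan.mk W j))
    (f : X ⟶ W), ∃ J : Set I, Cardinal.mk J < κ ∧ f ≫ restrict h J = f

lemma IsFinitelyPresentable.isSmallObject [HasCoproducts.{v} B] {X : B}
    (hB : ∀ (J : Type v) (cJ : SmallCategory J),
      (by exact IsFiltered J → HasColimitsOfShape J B : Prop))
    (hX : IsFinitelyPresentable B X) : IsSmallObject Cardinal.aleph0 X := by
  intro I V W j h f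
  have : HasFiniteCoproducts B := hasFiniteCoproducts_of_hasCoproducts B
  have : HasColimitsOfShape (Finset (Discrete I)) B := hB _ inferInstance inferInstance
  obtain ⟨_⟩ := hX (Finset (Discrete I)) inferInstance inferInstance
  have hc := isColimitOfPreserves (coyoneda.obj (Opposite.op X))
    (CoproductsFromFiniteFiltered.isColimitFiniteSubproductsCocone V)
  obtain ⟨s, g, hg⟩ : ∃ (s : Finset (Discrete I)) (g : X ⟶ ∐ fun i : s => V i.1.as),
      g ≫ Sigma.desc (fun i : s => Sigma.ι V i.1.as) =
        f ≫ Cofan.IsColimit.desc h (Sigma.ι V) :=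
    Types.jointly_surjective_of_isColimit hc _
  refine ⟨{i | Discrete.mk i ∈ s}, ?_, ?_⟩
  · rw [Cardinal.lt_aleph0_iff_set_finite]
    exact s.finite_toSet.preimage fun _ _ _ _ h => congrArg Discrete.as h
  · have h₁ : Cofan.IsColimit.desc h (Sigma.ι V) ≫ Sigma.desc j = 𝟙 W :=
      cofan_hom_ext h fun i => by simp
    have hf : f = g ≫ Sigma.desc (fun i : s => Sigma.ι V i.1.as) ≫ Sigma.desc j := by
      rw [reassoc_of% hg, h₁, Category.comp_id]
    rw [hf, Category.assoc, Category.assoc]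
    congr 1
    refine Limits.Sigma.hom_ext _ _ fun i => ?_
    have := inj_restrict_of_mem h (J := {i | Discrete.mk i ∈ s}) (i := i.1.as) i.2
    simp [this]

lemma IsSmallObject.of_isColimit {κ : Cardinal.{v}} (hκ : κ.IsRegular) {X : B} {J : Type v}
    [SmallCategory J] {D : J ⥤ B} {c : Cocone D} (hc : IsColimit c) (e : c.pt ≅ X)
    (hJ : Cardinal.mk J < κ) (hD : ∀ j, IsSmallObject κ (D.obj j)) : IsSmallObject κ X := by
  intro I V W j h f
  choose S hS hS' using fun k => hD k V W j h (c.ι.app k ≫ e.hom ≫ f)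
  refine ⟨⋃ k, S k, (Cardinal.card_iUnion_lt_iff_forall_of_isRegular hκ hJ).2 hS, ?_⟩
  rw [← cancel_epi e.hom]
  refine hc.hom_ext fun k => ?_
  have := comp_restrict_of_subset h (Set.subset_iUnion S k) (hS' k)
  simpa only [Category.assoc] using this

lemma IsSmallObject.mono {κ κ' : Cardinal.{v}} (h : κ ≤ κ') {X : B} (hX : IsSmallObject κ X) :
    IsSmallObject κ' X := fun V W j hj f =>
  let ⟨J, hJ, hf⟩ := hX V W j hj f
  ⟨J, hJ.trans_le h, hf⟩

lemma IsFinitelyAccessible.hasCoproducts [HasZeroObject B] [HasBinaryBiproducts B]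
    (hB : IsFinitelyAccessible B) : HasCoproducts.{v} B := by
  have : HasInitial B := HasZeroObject.hasInitial
  have : HasFiniteCoproducts B := hasFiniteCoproducts_of_has_binary_and_initial
  have : HasFilteredColimitsOfSize.{v, v} B := ⟨fun J _ _ => hB.1 J _ inferInstance⟩
  exact hasCoproducts_of_finite_and_filtered

/-- In a finitely accessible additive category, the objects of a set are all small with respect
to some uncountable regular cardinal. -/
lemma IsFinitelyAccessible.exists_isSmallObject [HasZeroObject B] [HasBinaryBiproducts B]
    (hB : IsFinitelyAccessible B) {ι : Type v} (X : ι → B) :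
    ∃ κ : Cardinal.{v}, κ.IsRegular ∧ Cardinal.aleph0 < κ ∧ ∀ i, IsSmallObject κ (X i) := by
  have := hB.hasCoproducts
  obtain ⟨hB', α, G, hG, h⟩ := hB
  choose p hp using h
  let μ : Cardinal.{v} := max Cardinal.aleph0 (Cardinal.mk (Σ i, (p (X i)).J))
  have hμ : Cardinal.aleph0 < Order.succ μ := Order.lt_succ_of_le (le_max_left _ _)
  have hκ : (Order.succ μ).IsRegular := Cardinal.isRegular_succ (le_max_left _ _)
  refine ⟨Order.succ μ, hκ, hμ, fun i => ?_⟩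
  refine IsSmallObject.of_isColimit hκ (p (X i)).hc (p (X i)).iso (Order.lt_succ_of_le
    (le_trans ?_ (le_max_right _ _))) fun j => ?_
  · exact Cardinal.mk_le_of_injective (f := fun j => (⟨i, j⟩ : Σ i, (p (X i)).J))
      fun _ _ h => by simpa using h
  · obtain ⟨a, ha⟩ := hp (X i) j
    rw [← ha]
    exact IsSmallObject.mono hμ.le ((hG a).isSmallObject hB')

end SmallObjects


section Sums

variable {B : Type u} [Category.{v} B]

/-- `V` is a coproduct of objects of the family `G`, with an index type satisfying `Φ`. -/
def IsSum {ι : Type v} (G : ι → B) (Φ : Type v → Prop) (V : B) : Prop :=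
  ∃ (E : Type v) (s : E → ι) (j : ∀ e, G (s e) ⟶ V),
    Φ E ∧ Nonempty (IsColimit (Cofan.mk V j))

variable {ι : Type v} {G : ι → B} {Φ : Type v → Prop}

lemma isSum_self (h : Φ PUnit) (i : ι) : IsSum G Φ (G i) :=
  ⟨PUnit, fun _ => i, fun _ => 𝟙 _, h,
    ⟨Cofan.IsColimit.mk _ (fun t => t.inj PUnit.unit) (fun _ _ => Category.id_comp _)
      fun t m hm => by simpa using hm PUnit.unit⟩⟩

lemma isSum_of_iso {V W : B} (e : V ≅ W) (h : IsSum G Φ V) : IsSum G Φ W := by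
  obtain ⟨E, s, j, hE, ⟨hj⟩⟩ := h
  exact ⟨E, s, fun k => j k ≫ e.hom, hE,
    ⟨hj.ofIsoColimit (Cofan.ext e fun _ => rfl)⟩⟩

lemma isSum_of_isZero (h : Φ PEmpty) {V : B} (hV : IsZero V) : IsSum G Φ V :=
  ⟨PEmpty, PEmpty.elim, fun k => k.elim, h,
    ⟨Cofan.IsColimit.mk _ (fun _ => hV.to_ _) (fun _ k => k.elim) fun _ _ _ => hV.eq_of_src _ _⟩⟩

lemma isSum_of_isColimit {I : Type v} {V : I → B} {W : B} {j : ∀ i, V i ⟶ W}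
    (h : IsColimit (Cofan.mk W j))
    (hΦ : ∀ E : I → Type v, (∀ i, Φ (E i)) → Φ (Σ i, E i)) (hV : ∀ i, IsSum G Φ (V i)) :
    IsSum G Φ W := by
  choose E s k hE hk using hV
  exact ⟨Σ i, E i, fun x => s x.1 x.2, fun x => k x.1 x.2 ≫ j x.1, hΦ E hE,
    ⟨Cofan.isColimitTrans _ h k fun i => (hk i).some⟩⟩

lemma isSum_biprod [HasZeroMorphisms B] [HasBinaryBiproducts B]
    (hΦ : ∀ E E' : Type v, Φ E → Φ E' → Φ (E ⊕ E')) {V W : B} (hV : IsSum G Φ V)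
    (hW : IsSum G Φ W) : IsSum G Φ (V ⊞ W) := by
  obtain ⟨E, s, j, hE, ⟨hj⟩⟩ := hV
  obtain ⟨E', s', j', hE', ⟨hj'⟩⟩ := hW
  refine ⟨E ⊕ E', Sum.elim s s', fun x => match x with
    | .inl k => j k ≫ biprod.inl
    | .inr k => j' k ≫ biprod.inr, hΦ E E' hE hE', ⟨Cofan.IsColimit.mk _
      (fun t => biprod.desc (Cofan.IsColimit.desc hj fun k => t.inj (.inl k))
        (Cofan.IsColimit.desc hj' fun k => t.inj (.inr k))) ?_ ?_⟩⟩
  · rintro t (k | k)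
    · exact (Category.assoc _ _ _).trans ((congrArg _ (biprod.inl_desc _ _)).trans
        (cofan_fac hj _ k))
    · exact (Category.assoc _ _ _).trans ((congrArg _ (biprod.inr_desc _ _)).trans
        (cofan_fac hj' _ k))
  · intro t m hm
    refine biprod.hom_ext' _ _ (cofan_hom_ext hj fun k => ?_) (cofan_hom_ext hj' fun k => ?_)
    · rw [biprod.inl_desc]
      exact (Category.assoc _ _ _).symm.trans ((hm (.inl k)).trans (cofan_fac hj
        (fun k => t.inj (.inl k)) k).symm)
    · rw [biprod.inr_desc]
      exact (Category.assoc _ _ _).symm.trans ((hm (.inr k)).trans (cofan_fac hj'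
        (fun k => t.inj (.inr k)) k).symm)

/-- A subset of the summands of a coproduct determines a retract of it. -/
lemma exists_split_restrict [HasCoproducts.{v} B] [Preadditive B] {E : Type v} {s : E → ι}
    {V : B} {j : ∀ e, G (s e) ⟶ V} (h : IsColimit (Cofan.mk V j)) (J : Set E) (hJ : Φ J) :
    ∃ (U : B) (a : U ⟶ V) (b : V ⟶ U), IsSum G Φ U ∧ a ≫ b = 𝟙 U ∧ b ≫ a = restrict h J := by
  classical
  refine ⟨∐ fun e : J => G (s e), Sigma.desc fun e => j e,
    Cofan.IsColimit.desc h fun e => if he : e ∈ J then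
      Sigma.ι (fun e : J => G (s e)) ⟨e, he⟩ else 0,
    ⟨J, fun e => s e, Sigma.ι _, hJ, ⟨coproductIsCoproduct _⟩⟩, ?_, ?_⟩
  · refine Limits.Sigma.hom_ext _ _ fun e => ?_
    simp
  · refine cofan_hom_ext h fun e => ?_
    by_cases he : e ∈ J
    · simp [inj_restrict_of_mem h he, he]
    · simp [inj_restrict_of_notMem h he, he]

end Sums

section Coproducts

variable {B : Type u} [Category.{v} B] [Preadditive B]

lemma exists_degreewise_coproduct [HasCoproducts.{v} B] {I : Type v}
    (C : I → CochainComplex B ℤ) :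
    ∃ (W : CochainComplex B ℤ) (w : ∀ i, C i ⟶ W),
      ∀ n, Nonempty (IsColimit (Cofan.mk (W.X n) fun i => (w i).f n)) := by
  refine ⟨{
    X n := ∐ fun i => (C i).X n
    d n m := Limits.Sigma.map fun i => (C i).d n m
    shape n m h := Limits.Sigma.hom_ext _ _ fun i => by simp [(C i).shape n m h]
    d_comp_d' _ _ _ _ _ := Limits.Sigma.hom_ext _ _ fun i => by simp }, fun i => {
      f n := Sigma.ι (fun i => (C i).X n) i
      comm' _ _ _ := by simp }, fun n => ⟨coproductIsCoproduct _⟩⟩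

variable {I : Type v} {C : I → CochainComplex B ℤ} {W : CochainComplex B ℤ} {w : ∀ i, C i ⟶ W}

lemma exists_desc_of_degreewise
    (hW : ∀ n, IsColimit (Cofan.mk (W.X n) fun i => (w i).f n)) {X : CochainComplex B ℤ}
    (f : ∀ i, C i ⟶ X) : ∃ F : W ⟶ X, ∀ i, w i ≫ F = f i := by
  refine ⟨{
    f n := Cofan.IsColimit.desc (hW n) fun i => (f i).f n
    comm' n m _ := cofan_hom_ext (hW n) fun i => ?_ }, fun i => ?_⟩
  · rw [cofan_fac_assoc (hW n), HomologicalComplex.Hom.comm_assoc, cofan_fac (hW m),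
      HomologicalComplex.Hom.comm]
  · ext n
    exact cofan_fac (hW n) _ i

lemma quotient_map_eq_zero_of_degreewise
    (hW : ∀ n, IsColimit (Cofan.mk (W.X n) fun i => (w i).f n)) {X : CochainComplex B ℤ}
    (μ : W ⟶ X) (h : ∀ i, (HomotopyCategory.quotient B (.up ℤ)).map (w i ≫ μ) = 0) :
    (HomotopyCategory.quotient B (.up ℤ)).map μ = 0 := by
  simp only [HomotopyCategory.quotient_map_eq_zero_iff] at h
  have H (i : I) := (h i).some
  refine (HomotopyCategory.quotient_map_eq_zero_iff _).2 ⟨{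
    hom a b := Cofan.IsColimit.desc (hW a) fun i => (H i).hom a b
    zero a b hab := cofan_hom_ext (hW a) fun i => by
      rw [cofan_fac (hW a), (H i).zero a b hab, comp_zero]
    comm n := cofan_hom_ext (hW n) fun i => ?_ }⟩
  have := (H i).comm n
  simp only [HomologicalComplex.comp_f, HomologicalComplex.zero_f, add_zero] at this ⊢
  rw [this, Preadditive.comp_add, ← dNext_comp_left, ← prevD_comp_left]
  simp only [cofan_fac (hW _)]

/-- Degreewise coproducts of complexes are coproducts in the homotopy category. -/
lemma isColimit_quotient
    (hW : ∀ n, IsColimit (Cofan.mk (W.X n) fun i => (w i).f n)) :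
    Nonempty (IsColimit (Cofan.mk ((HomotopyCategory.quotient B (.up ℤ)).obj W)
      fun i => (HomotopyCategory.quotient B (.up ℤ)).map (w i))) := by
  have key (t : Cofan fun i => (HomotopyCategory.quotient B (.up ℤ)).obj (C i)) :
      ∃ F : (HomotopyCategory.quotient B (.up ℤ)).obj W ⟶ t.pt,
        ∀ i, (HomotopyCategory.quotient B (.up ℤ)).map (w i) ≫ F = t.inj i := by
    obtain ⟨X, hX⟩ := HomotopyCategory.quotient_obj_surjective t.pt
    obtain ⟨P, t, rfl⟩ : ∃ P τ, t = Cofan.mk P τ := ⟨t.pt, t.inj, rfl⟩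
    obtain rfl : _ = P := hX
    choose f hf using fun i => (HomotopyCategory.quotient B (.up ℤ)).map_surjective (t i)
    obtain ⟨F, hF⟩ := exists_desc_of_degreewise hW f
    exact ⟨(HomotopyCategory.quotient B (.up ℤ)).map F, fun i => by
      rw [← Functor.map_comp, hF, hf]; rfl⟩
  choose F hF using key
  refine ⟨Cofan.IsColimit.mk _ F hF fun t m hm => ?_⟩
  obtain ⟨P, t, rfl⟩ : ∃ P τ, t = Cofan.mk P τ := ⟨t.pt, t.inj, rfl⟩
  obtain ⟨X, rfl⟩ := HomotopyCategory.quotient_obj_surjective P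
  suffices ∀ m' : (HomotopyCategory.quotient B (.up ℤ)).obj W ⟶
      (HomotopyCategory.quotient B (.up ℤ)).obj X,
      (∀ i, (HomotopyCategory.quotient B (.up ℤ)).map (w i) ≫ m' = 0) → m' = 0 from
    sub_eq_zero.1 (this _ fun i => (Preadditive.comp_sub _ _ _).trans
      (sub_eq_zero.2 ((hm i).trans (hF _ i).symm)))
  intro m' hm'
  obtain ⟨μ, rfl⟩ := (HomotopyCategory.quotient B (.up ℤ)).map_surjective m'
  exact quotient_map_eq_zero_of_degreewise hW μ fun i => (Functor.map_comp _ _ _).trans (hm' i)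

lemma hasCoproducts_homotopyCategory [HasCoproducts.{v} B] :
    HasCoproducts.{v} (HomotopyCategory B (.up ℤ)) := by
  have key {I : Type v} (X : I → HomotopyCategory B (.up ℤ)) :
      ∃ c : Cofan X, Nonempty (IsColimit c) := by
    obtain ⟨W, w, hW⟩ := exists_degreewise_coproduct fun i => (X i).as
    exact ⟨_, isColimit_quotient fun n => (hW n).some⟩
  exact hasCoproducts_of_colimit_cofans (fun f => (key f).choose)
    fun f => (key f).choose_spec.some

end Coproducts

section Termwise

open CategoryTheory.Pretriangulated ZeroObject HomotopyCategory

variable {B : Type u} [Category.{v} B] [Preadditive B]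

/-- The objects of the homotopy category which are isomorphic to a complex whose components are
coproducts of objects of `G`, with index types satisfying `Φ`. -/
def TermwiseSum {ι : Type v} (G : ι → B) (Φ : Type v → Prop) :
    Set (HomotopyCategory B (.up ℤ)) :=
  {X | ∃ C : CochainComplex B ℤ, (∀ n, IsSum G Φ (C.X n)) ∧
    Nonempty ((quotient B (.up ℤ)).obj C ≅ X)}

variable {ι : Type v} {G : ι → B} {Φ : Type v → Prop}

lemma termwiseSum_of_iso {X Y : HomotopyCategory B (.up ℤ)} (e : X ≅ Y)
    (hX : X ∈ TermwiseSum G Φ) : Y ∈ TermwiseSum G Φ := by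
  obtain ⟨C, hC, ⟨e'⟩⟩ := hX
  exact ⟨C, hC, ⟨e' ≪≫ e⟩⟩

lemma termwiseSum_of_isColimit [HasCoproducts.{v} B] {I : Type v}
    {X : I → HomotopyCategory B (.up ℤ)}
    (hX : ∀ i, X i ∈ TermwiseSum G Φ)
    (hΦ : ∀ E : I → Type v, (∀ i, Φ (E i)) → Φ (Σ i, E i)) (c : Cofan X) (hc : IsColimit c) :
    c.pt ∈ TermwiseSum G Φ := by
  choose C hC e using hX
  obtain ⟨W, w, hW⟩ := exists_degreewise_coproduct C
  obtain ⟨h⟩ := isColimit_quotient fun n => (hW n).some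
  exact ⟨W, fun n => isSum_of_isColimit (hW n).some hΦ fun i => hC i n,
    ⟨h.coconePointsIsoOfNatIso hc (Discrete.natIso fun i => (e i.as).some)⟩⟩

lemma shift_mem_termwiseSum {X : HomotopyCategory B (.up ℤ)} (hX : X ∈ TermwiseSum G Φ)
    (n : ℤ) : X⟦n⟧ ∈ TermwiseSum G Φ := by
  obtain ⟨C, hC, ⟨e⟩⟩ := hX
  exact ⟨C⟦n⟧, fun m => hC (m + n),
    ⟨((quotient B (.up ℤ)).commShiftIso n).app C ≪≫ (shiftFunctor _ n).mapIso e⟩⟩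

variable [HasZeroObject B]

lemma zero_mem_termwiseSum (h : Φ PEmpty) :
    (0 : HomotopyCategory B (.up ℤ)) ∈ TermwiseSum G Φ :=
  ⟨0, fun n => isSum_of_isZero h
    ((HomologicalComplex.eval B _ n).map_isZero (isZero_zero _)),
    ⟨((quotient B (.up ℤ)).map_isZero (isZero_zero _)).isoZero⟩⟩

variable [HasBinaryBiproducts B]

lemma obj₂_mem_termwiseSum (hΦ : ∀ E E' : Type v, Φ E → Φ E' → Φ (E ⊕ E'))
    (D : Triangle (HomotopyCategory B (.up ℤ))) (hD : D ∈ distTriang _)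
    (h₁ : D.obj₁ ∈ TermwiseSum G Φ) (h₃ : D.obj₃ ∈ TermwiseSum G Φ) :
    D.obj₂ ∈ TermwiseSum G Φ := by
  obtain ⟨K, hK, ⟨e⟩⟩ := shift_mem_termwiseSum h₃ (-1)
  obtain ⟨L, hL, ⟨e'⟩⟩ := h₁
  obtain ⟨f, hf⟩ := (quotient B (.up ℤ)).map_surjective
    (e.hom ≫ D.invRotate.mor₁ ≫ e'.inv)
  have iso := isoTriangleOfIso₁₂ (CochainComplex.mappingCone.triangleh f) D.invRotate
    (mappingCone_triangleh_distinguished f) (inv_rot_of_distTriang _ hD) e e' (by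
      have h (x : D.obj₃⟦(-1 : ℤ)⟧ ⟶ D.obj₁) : (e.hom ≫ x ≫ e'.inv) ≫ e'.hom = e.hom ≫ x := by
        simp
      change (quotient B (.up ℤ)).map f ≫ e'.hom = _
      rw [hf]
      exact h _)
  refine ⟨CochainComplex.mappingCone f, fun n => ?_, ⟨Triangle.π₃.mapIso iso⟩⟩
  exact isSum_of_iso (HomologicalComplex.homotopyCofiber.XIsoBiprod f n (n + 1) rfl).symm
    (isSum_biprod hΦ (hK _) (hL _))

variable [HasCoproducts.{v} B]

lemma isLocalizing_termwiseSum (G : ι → B) :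
    IsLocalizing (HomotopyCategory B (.up ℤ)) (TermwiseSum G fun _ => True) where
  zero := zero_mem_termwiseSum trivial
  isoClosed := termwiseSum_of_iso
  shiftClosed _ n hX := shift_mem_termwiseSum hX n
  ext₂ := obj₂_mem_termwiseSum fun _ _ _ _ => trivial
  coproductClosed _ hX := termwiseSum_of_isColimit hX fun _ _ => trivial

lemma isKappaLocalizing_termwiseSum {κ : Cardinal.{v}} (hκ : κ.IsRegular) (G : ι → B) :
    IsKappaLocalizing (HomotopyCategory B (.up ℤ)) κ
      (TermwiseSum G fun E => Cardinal.mk E < κ) where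
  zero := zero_mem_termwiseSum (by simpa using hκ.pos)
  isoClosed := termwiseSum_of_iso
  shiftClosed _ n hX := shift_mem_termwiseSum hX n
  ext₂ := obj₂_mem_termwiseSum fun E E' h h' => by
    rw [Cardinal.mk_sum, Cardinal.lift_id, Cardinal.lift_id]
    exact Cardinal.add_lt_of_lt hκ.aleph0_le h h'
  coproductClosed _ hI hX := termwiseSum_of_isColimit hX fun E hE => by
    rw [Cardinal.mk_sigma]
    exact Cardinal.sum_lt_of_isRegular hκ hI hE

end Termwise

section Approximation

variable {B : Type u} [Category.{v} B] [Preadditive B]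

/-- A differential-stable family of split idempotents on the components of a complex defines a
subcomplex which is degreewise a retract. -/
lemma exists_complex_of_split (C : CochainComplex B ℤ) (U : ℤ → B)
    (a : ∀ n, U n ⟶ C.X n) (b : ∀ n, C.X n ⟶ U n) (hab : ∀ n, a n ≫ b n = 𝟙 _)
    (hd : ∀ n m, (ComplexShape.up ℤ).Rel n m →
      (b n ≫ a n) ≫ C.d n m ≫ b m ≫ a m = (b n ≫ a n) ≫ C.d n m) :
    ∃ (Z : CochainComplex B ℤ) (_ : ∀ n, Z.X n = U n) (φ : Z ⟶ C) (π : ∀ n, C.X n ⟶ Z.X n),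
      (∀ n, φ.f n ≫ π n = 𝟙 _) ∧ ∀ n, π n ≫ φ.f n = b n ≫ a n := by
  have hd' (n m : ℤ) : a n ≫ C.d n m ≫ b m ≫ a m = a n ≫ C.d n m := by
    by_cases h : (ComplexShape.up ℤ).Rel n m
    · simpa [reassoc_of% hab n] using congrArg (a n ≫ ·) (hd n m h)
    · simp [C.shape n m h]
  refine ⟨{
    X := U
    d n m := a n ≫ C.d n m ≫ b m
    shape n m h := by simp [C.shape n m h]
    d_comp_d' n m k _ _ := by
      have := congrArg (· ≫ C.d m k ≫ b k) (hd' n m)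
      simpa using this }, fun _ => rfl, {
    f := a
    comm' n m _ := by simpa using (hd' n m).symm }, b, hab, fun _ => rfl⟩

open Cardinal in
/-- A morphism from a complex with small components to a degreewise coproduct of complexes whose
components are sums of objects of `G` factors through a coproduct of complexes with small
components. -/
lemma exists_factorization [HasCoproducts.{v} B] {ι : Type v} {G : ι → B} {κ : Cardinal.{v}}
    (hκ : κ.IsRegular) (hκ' : ℵ₀ < κ) (hG : ∀ i, IsSmallObject κ (G i))
    {Y W : CochainComplex B ℤ} {I : Type v} {C : I → CochainComplex B ℤ} {w : ∀ i, C i ⟶ W}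
    (hW : ∀ n, IsColimit (Cofan.mk (W.X n) fun i => (w i).f n))
    (hY : ∀ n, IsSum G (fun E => #E < κ) (Y.X n))
    (hC : ∀ i n, IsSum G (fun _ => True) ((C i).X n)) (f : Y ⟶ W) :
    ∃ (Z : I → CochainComplex B ℤ) (φ : ∀ i, Z i ⟶ C i),
      (∀ i n, IsSum G (fun E => #E < κ) ((Z i).X n)) ∧ #{i | φ i ≠ 0} < κ ∧
      ∀ (V : CochainComplex B ℤ) (z : ∀ i, Z i ⟶ V)
        (_ : ∀ n, IsColimit (Cofan.mk (V.X n) fun i => (z i).f n)) (r : V ⟶ W),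
        (∀ i, z i ≫ r = φ i ≫ w i) → ∃ g : Y ⟶ V, g ≫ r = f := by
  choose E s j _ hj using hC
  choose A t k hA hk using hY
  have hbig (n : ℤ) : IsColimit (Cofan.mk (W.X n)
      fun x : Σ i, E i n => j x.1 n x.2 ≫ (w x.1).f n) := Cofan.isColimitTrans _ (hW n) (fun i => j i n) fun i => (hj i n).some
  choose S hS hSf using fun (n : ℤ) (a : A n) => hG (t n a) _ _ _ (hbig n) (k n a ≫ f.f n)
  choose D hD hDd using fun (i : I) (n : ℤ) (e : E i n) =>
    hG (s i n e) _ _ _ (hj i (n + 1)).some (j i n e ≫ (C i).d n (n + 1))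
  obtain ⟨T, hT, hTκ, hTD⟩ := exists_stable_superset hκ hκ' (E := Σ i, Σ n, E i n)
    (fun x => (fun e => (⟨x.1, x.2.1 + 1, e⟩ : Σ i, Σ n, E i n)) '' D x.1 x.2.1 x.2.2)
    (fun x => mk_image_le.trans_lt (hD _ _ _))
    (⋃ n, ⋃ a, (fun x : Σ i, E i n => (⟨x.1, n, x.2⟩ : Σ i, Σ n, E i n)) '' S n a)
    (mk_iUnion_lt_of_countable hκ hκ' _ fun n =>
      (card_iUnion_lt_iff_forall_of_isRegular hκ (hA n)).2 fun a =>
        mk_image_le.trans_lt (hS n a))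
  have hJ (i : I) (n : ℤ) : #{e | (⟨i, n, e⟩ : Σ i, Σ n, E i n) ∈ T} < κ :=
    (mk_le_of_injective (f := fun e => (⟨_, e.2⟩ : T)) fun e e' h => by
      simpa [Subtype.ext_iff] using h).trans_lt hTκ
  choose U a b hU hab hba using fun i n => exists_split_restrict (Φ := fun E => #E < κ)
    (hj i n).some {e | (⟨i, n, e⟩ : Σ i, Σ n, E i n) ∈ T} (hJ i n)
  choose Z hZ φ π hφπ hπφ using fun i => exists_complex_of_split (C i) (U i) (a i) (b i)
    (hab i) (by
      rintro n _ rfl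
      refine cofan_hom_ext (hj i n).some fun e => ?_
      rw [hba, hba]
      by_cases he : (⟨i, n, e⟩ : Σ i, Σ n, E i n) ∈ T
      · rw [← Category.assoc, inj_restrict_of_mem (hj i n).some he, ← Category.assoc,
          comp_restrict_of_subset (hj i (n + 1)).some _ (hDd i n e), ← Category.assoc,
          inj_restrict_of_mem (hj i n).some he]
        exact fun e' he' => hTD _ he ⟨e', he', rfl⟩
      · rw [← Category.assoc, inj_restrict_of_notMem (hj i n).some he, zero_comp,
          ← Category.assoc, inj_restrict_of_notMem (hj i n).some he, zero_comp])
  refine ⟨Z, φ, fun i n => by rw [hZ]; exact hU i n, ?_, fun V z hV r hr => ?_⟩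
  · refine (mk_le_mk_of_subset fun i hi => ?_).trans_lt
      ((mk_image_le (f := fun x : Σ i, Σ n, E i n => x.1)).trans_lt hTκ)
    by_contra hi'
    refine hi (HomologicalComplex.hom_ext _ _ fun n => ?_)
    have h₀ : π i n ≫ (φ i).f n = 0 := by
      rw [hπφ, hba]
      refine cofan_hom_ext (hj i n).some fun e => ?_
      rw [inj_restrict_of_notMem (hj i n).some fun he => hi' ⟨_, he, rfl⟩, comp_zero]
    rw [← Category.id_comp ((φ i).f n), ← hφπ, Category.assoc, h₀, comp_zero]
    rfl
  · have hr' (i : I) (n : ℤ) : (z i).f n ≫ r.f n = (φ i).f n ≫ (w i).f n :=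
      HomologicalComplex.congr_hom (hr i) n
    let Q (n : ℤ) : W.X n ⟶ V.X n :=
      Cofan.IsColimit.desc (hW n) fun i => π i n ≫ (z i).f n
    have hQ (i : I) (n : ℤ) : (w i).f n ≫ Q n = π i n ≫ (z i).f n := cofan_fac (hW n) _ i
    have hrQ (n : ℤ) : r.f n ≫ Q n = 𝟙 _ := cofan_hom_ext (hV n) fun i => by
      rw [reassoc_of% hr' i n, hQ, reassoc_of% hφπ i n, Category.comp_id]
    have hQr (n : ℤ) : Q n ≫ r.f n = restrict (hbig n)
        {x | (⟨x.1, n, x.2⟩ : Σ i, Σ n, E i n) ∈ T} := by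
      refine cofan_hom_ext (hbig n) ?_
      rintro ⟨i, e⟩
      change (j i n e ≫ (w i).f n) ≫ Q n ≫ r.f n = _
      rw [Category.assoc, reassoc_of% hQ i n, hr', reassoc_of% hπφ i n]
      rw [← Category.assoc (b i n), hba]
      by_cases he : (⟨i, n, e⟩ : Σ i, Σ n, E i n) ∈ T
      · rw [← Category.assoc, inj_restrict_of_mem (hj i n).some he]
        exact (inj_restrict_of_mem (hbig n) (i := ⟨i, e⟩) he).symm
      · rw [← Category.assoc, inj_restrict_of_notMem (hj i n).some he, zero_comp]
        exact (inj_restrict_of_notMem (hbig n) (i := ⟨i, e⟩) he).symm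
    have hf (n : ℤ) : f.f n ≫ Q n ≫ r.f n = f.f n := by
      rw [hQr]
      refine cofan_hom_ext (hk n).some fun x => ?_
      rw [← Category.assoc]
      refine comp_restrict_of_subset (hbig n) (fun y hy => hT ?_) (hSf n x)
      exact Set.mem_iUnion.2 ⟨n, Set.mem_iUnion.2 ⟨x, y, hy, rfl⟩⟩
    have hmono (n : ℤ) : Mono (r.f n) := mono_of_mono_fac (hrQ n)
    refine ⟨{
      f n := f.f n ≫ Q n
      comm' n m _ := by
        rw [← cancel_mono (r.f m)]
        simp only [Category.assoc, ← r.comm, hf]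
        rw [← Category.assoc, ← Category.assoc, Category.assoc (f.f n), hf, f.comm] }, ?_⟩
    ext n
    simpa using hf n

end Approximation

section LocallyWellGenerated

open HomotopyCategory

variable {B : Type u} [Category.{v} B] [Preadditive B] [HasCoproducts.{v} B]
  {ι : Type v} {G : ι → B} {κ : Cardinal.{v}}

lemma approximates_termwiseSum [HasCoproducts.{v} (HomotopyCategory B (.up ℤ))]
    (hκ : κ.IsRegular) (hκ' : Cardinal.aleph0 < κ) (hG : ∀ i, IsSmallObject κ (G i)) :
    Approximates κ (TermwiseSum G fun _ => True) (TermwiseSum G fun E => Cardinal.mk E < κ)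
      (TermwiseSum G fun E => Cardinal.mk E < κ) := by
  rintro Y ⟨K, hK, ⟨eY⟩⟩ I X hX f
  choose C hC e using hX
  replace e (i : I) := (e i).some
  obtain ⟨W, w, hW⟩ := exists_degreewise_coproduct C
  replace hW (n : ℤ) := (hW n).some
  obtain ⟨hW'⟩ := isColimit_quotient hW
  let d : ∐ X ⟶ (quotient B (.up ℤ)).obj W :=
    Sigma.desc fun i => (e i).inv ≫ (quotient B (.up ℤ)).map (w i)
  let d' : (quotient B (.up ℤ)).obj W ⟶ ∐ X :=
    Cofan.IsColimit.desc hW' fun i => (e i).hom ≫ Sigma.ι X i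
  have hd' (i : I) : (quotient B (.up ℤ)).map (w i) ≫ d' = (e i).hom ≫ Sigma.ι X i :=
    cofan_fac hW' _ i
  have hdd' : d ≫ d' = 𝟙 _ := Limits.Sigma.hom_ext _ _ fun i => by simp [d, hd']
  obtain ⟨F, hF⟩ := (quotient B (.up ℤ)).map_surjective (eY.hom ≫ f ≫ d)
  obtain ⟨Z, φ, hZ, hφ, h⟩ := exists_factorization hκ hκ' hG hW hK hC F
  obtain ⟨V, z, hV⟩ := exists_degreewise_coproduct Z
  replace hV (n : ℤ) := (hV n).some
  obtain ⟨hV'⟩ := isColimit_quotient hV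
  obtain ⟨r, hr⟩ := exists_desc_of_degreewise hV fun i => φ i ≫ w i
  obtain ⟨g, hg⟩ := h V z hV r hr
  let q : (quotient B (.up ℤ)).obj V ⟶ ∐ fun i => (quotient B (.up ℤ)).obj (Z i) :=
    Cofan.IsColimit.desc hV' fun i => Sigma.ι (fun i => (quotient B (.up ℤ)).obj (Z i)) i
  have hq (i : I) : (quotient B (.up ℤ)).map (z i) ≫ q =
      Sigma.ι (fun i => (quotient B (.up ℤ)).obj (Z i)) i := cofan_fac hV' _ i
  refine ⟨fun i => (quotient B (.up ℤ)).obj (Z i),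
    fun i => (quotient B (.up ℤ)).map (φ i) ≫ (e i).hom,
    eY.inv ≫ (quotient B (.up ℤ)).map g ≫ q, fun i => ⟨Z i, hZ i, ⟨Iso.refl _⟩⟩,
    (Cardinal.mk_le_mk_of_subset (t := {i | φ i ≠ 0}) fun i hi => ?_).trans_lt hφ, ?_⟩
  · intro h₀
    refine hi ?_
    beta_reduce
    rw [h₀, Functor.map_zero, zero_comp]
  · have hqr : q ≫ Limits.Sigma.map (fun i => (quotient B (.up ℤ)).map (φ i) ≫ (e i).hom) =
        (quotient B (.up ℤ)).map r ≫ d' := by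
      refine cofan_hom_ext hV' fun i => ?_
      rw [reassoc_of% hq i, ← Functor.map_comp_assoc, hr, Functor.map_comp_assoc, hd']
      simp
    rw [Category.assoc, Category.assoc, hqr, ← Functor.map_comp_assoc, hg, hF]
    simp [hdd']

/-- The complexes with prescribed small sums as components form a set up to isomorphism. -/
lemma exists_representatives_termwiseSum (G : ι → B) (κ : Cardinal.{v}) :
    ∃ (A : Type v) (R : A → HomotopyCategory B (.up ℤ)),
      ∀ X ∈ TermwiseSum G fun E => Cardinal.mk E < κ, ∃ a, Nonempty (R a ≅ X) := by
  let O : Type v := Σ E : Set κ.ord.ToType, E → ι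
  let F (x : O) : B := ∐ fun e => G (x.2 e)
  have hF {V : B} (hV : IsSum G (fun E => Cardinal.mk E < κ) V) :
      ∃ x : O, Nonempty (F x ≅ V) := by
    obtain ⟨E, s, j, hE, ⟨hj⟩⟩ := hV
    obtain ⟨ε⟩ : Nonempty (E ↪ κ.ord.ToType) := by
      rw [← Cardinal.le_def, Cardinal.mk_ord_toType]
      exact hE.le
    let e := Equiv.ofInjective ε ε.injective
    exact ⟨⟨Set.range ε, s ∘ e.symm⟩, ⟨Sigma.reindex e.symm (fun k => G (s k)) ≪≫
      (coproductIsCoproduct _).coconePointUniqueUpToIso hj⟩⟩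
  let A := Σ x : ℤ → O, {d : ∀ n m, F (x n) ⟶ F (x m) //
    (∀ n m, ¬ (ComplexShape.up ℤ).Rel n m → d n m = 0) ∧ ∀ n m k, d n m ≫ d m k = 0}
  refine ⟨A, fun a => (quotient B (.up ℤ)).obj {
    X n := F (a.1 n)
    d := a.2.1
    shape := a.2.2.1
    d_comp_d' n m k _ _ := a.2.2.2 n m k }, ?_⟩
  rintro X ⟨C, hC, ⟨e⟩⟩
  choose x hx using fun n => hF (hC n)
  replace hx (n : ℤ) := (hx n).some
  exact ⟨⟨x, fun n m => (hx n).hom ≫ C.d n m ≫ (hx m).inv,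
    fun n m h => by simp [C.shape n m h], fun n m k => by simp⟩,
    ⟨(quotient B (.up ℤ)).mapIso
      (HomologicalComplex.Hom.isoOfComponents hx fun n m _ => by simp) ≪≫ e⟩⟩

end LocallyWellGenerated

/-- the homotopy category of complexes over a finitely accessible additive
category is locally well generated. -/
theorem homotopyCategory_finitelyAccessible_locallyWellGenerated
    (B : Type u) [Category.{v} B] [Preadditive B] [HasZeroObject B] [HasBinaryBiproducts B]
    (hB : IsFinitelyAccessible B) :
    IsLocallyWellGenerated (HomotopyCategory B (ComplexShape.up ℤ)) := by
  intro S _ _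
  have : HasCoproducts.{v} B := hB.hasCoproducts
  have : HasCoproducts.{v} (HomotopyCategory B (.up ℤ)) := hasCoproducts_homotopyCategory
  let C (x : Shrink.{v} S) : CochainComplex B ℤ := ((equivShrink S).symm x).1.as
  let G (x : Shrink.{v} S × ℤ) : B := (C x.1).X x.2
  obtain ⟨κ, hκ, hκ', hG⟩ := hB.exists_isSmallObject G
  have hS {Φ : Type v → Prop} (hΦ : Φ PUnit) : S ⊆ TermwiseSum G Φ := fun X hX =>
    ⟨X.as, fun n => by simpa [G, C] using isSum_self (G := G) hΦ (equivShrink S ⟨X, hX⟩, n),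
      ⟨Iso.refl _⟩⟩
  obtain ⟨A, R, hR⟩ := exists_representatives_termwiseSum G κ
  exact ⟨κ, isWellGeneratedOfCard_loc hκ (isLocalizing_termwiseSum G)
    (isKappaLocalizing_termwiseSum hκ G) (approximates_termwiseSum hκ hκ' hG) R hR
    (hS (by simpa using Cardinal.one_lt_aleph0.trans hκ')) (hS trivial)⟩

end LocWellGen
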